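/- arXiv:1904.05001 — 4 statements merged into one kernel-verified Lean document; each statement's English description precedes it below -/
import Mathlib

section
/- (Corollary 1.) Let G = (V, E) be a connected finite simple graph with |V| = N ≥ 2 and a proper k-coloring with color classes V_1, …, V_k, and let P_l = ∏_{i ∈ V_l} (S_i + I)/2. Then every bi-separable density matrix ρ — i.e., every ρ of the form ρ = Σ_i p_i |ψ_i⟩⟨ψ_i| with p_i ≥ 0, Σ_i p_i = 1, and each ψ_i a unit vector that is a product vector across the bipartition {A^{(i)}, V \ A^{(i)}} for some nonempty proper subset A^{(i)} ⊆ V — satisfies Σ_{l=1}^k Tr(P_l ρ) ≤ k − 1/2. -/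
open Matrix Finset
open scoped Classical ComplexOrder

noncomputable section

variable {V : Type} [Fintype V] [DecidableEq V]

/-- The indicator function δ_i : V → ZMod 2 of a vertex `i`. -/
def delta (i : V) : V → ZMod 2 := fun v => if v = i then 1 else 0

/-- The stabilizer `S_i = X_i ⊗_{j ∈ N(i)} Z_j` of the graph `G` at vertex `i`,
as a matrix acting on the N-qubit Hilbert space `(V → ZMod 2) → ℂ`:
`(S_i ψ)(x) = (-1)^{∑_{j ∈ N(i)} x(j)} ψ(x + δ_i)`. -/
def stab (G : SimpleGraph V) (i : V) : Matrix (V → ZMod 2) (V → ZMod 2) ℂ :=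
  Matrix.of fun x y =>
    if y = x + delta i then ((-1 : ℂ) ^ (∑ j ∈ univ.filter (fun j => G.Adj i j), (x j).val))
    else 0

/-- The number of edges `{i,j}` of `G` with `x i = x j = 1`. -/
def edgeCount (G : SimpleGraph V) (x : V → ZMod 2) : ℕ :=
  (G.edgeFinset.filter (fun e => ∀ v ∈ e, x v = 1)).card

/-- The graph state of `G`: `g(x) = 2^{-N/2} (-1)^{e(x)}`. -/
def graphState (G : SimpleGraph V) : (V → ZMod 2) → ℂ :=
  fun x => ((-1 : ℂ) ^ edgeCount G x) / ((Real.sqrt 2 ^ Fintype.card V : ℝ) : ℂ)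

/-- The stabilizer projector `∏_{i ∈ W} (S_i + I)/2` (the factors pairwise commute, so
the order of multiplication is irrelevant; we use the canonical enumeration of `W`). -/
def stabProj (G : SimpleGraph V) (W : Finset V) : Matrix (V → ZMod 2) (V → ZMod 2) ℂ :=
  (W.toList.map (fun i => (2:ℂ)⁻¹ • (stab G i + 1))).prod

/-- The off-diagonal adjacency block `Γ_{A,Ā}` over `ZMod 2`. -/
def gammaMat (G : SimpleGraph V) (A : Finset V) :
    Matrix {v // v ∈ A} {v // v ∉ A} (ZMod 2) :=
  Matrix.of fun i j => if G.Adj i.1 j.1 then 1 else 0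

/-- `r(A)`: the rank of `Γ_{A,Ā}` over `ZMod 2`. -/
def gRank (G : SimpleGraph V) (A : Finset V) : ℕ := (gammaMat G A).rank

/-- Restriction of a computational-basis label to a subset `A`. -/
def restrictTo (A : Finset V) (x : V → ZMod 2) : {v // v ∈ A} → ZMod 2 := fun v => x v.1

/-- Restriction of a computational-basis label to the complement of `A`. -/
def restrictOut (A : Finset V) (x : V → ZMod 2) : {v // v ∉ A} → ZMod 2 := fun v => x v.1

/-- `ψ` is a product vector across the bipartition `{A, V \ A}`. -/
def IsProdVec (A : Finset V) (ψ : (V → ZMod 2) → ℂ) : Prop :=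
  ∃ (φ : ({v // v ∈ A} → ZMod 2) → ℂ) (χ : ({v // v ∉ A} → ZMod 2) → ℂ),
    ∀ x, ψ x = φ (restrictTo A x) * χ (restrictOut A x)

/-- `P : Fin m → Finset V` is a partition of `V` into `m` nonempty disjoint subsets. -/
def IsPartition {m : ℕ} (P : Fin m → Finset V) : Prop :=
  (∀ t, (P t).Nonempty) ∧ (∀ t t', t ≠ t' → Disjoint (P t) (P t')) ∧
    univ.biUnion P = univ

/-- `ψ` is a unit vector: `⟨ψ, ψ⟩ = 1`. -/
def IsUnit' (ψ : (V → ZMod 2) → ℂ) : Prop := star ψ ⬝ᵥ ψ = 1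

/-- A pure state fully separable with respect to the partition `P`:
`ψ(x) = ∏_t φ_t(x|_{A_t})`. -/
def FullSepPure {m : ℕ} (P : Fin m → Finset V) (ψ : (V → ZMod 2) → ℂ) : Prop :=
  ∃ φ : (t : Fin m) → ({v // v ∈ P t} → ZMod 2) → ℂ,
    ∀ x, ψ x = ∏ t, φ t (restrictTo (P t) x)

/-- A `P`-fully separable density matrix. -/
def FullSep {m : ℕ} (P : Fin m → Finset V) (ρ : Matrix (V → ZMod 2) (V → ZMod 2) ℂ) : Prop :=
  ∃ (M : ℕ) (p : Fin M → ℝ) (ψ : Fin M → ((V → ZMod 2) → ℂ)),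
    (∀ i, 0 ≤ p i) ∧ (∑ i, p i) = 1 ∧ (∀ i, IsUnit' (ψ i)) ∧
    (∀ i, FullSepPure P (ψ i)) ∧
    ρ = ∑ i, (p i : ℂ) • vecMulVec (ψ i) (star (ψ i))

/-- A `P`-bi-separable density matrix: a convex mixture of unit vectors each of which is a
product vector across `{A, V \ A}` for some nonempty proper union of parts `A` of `P`. -/
def BiSep {m : ℕ} (P : Fin m → Finset V) (ρ : Matrix (V → ZMod 2) (V → ZMod 2) ℂ) : Prop :=
  ∃ (M : ℕ) (p : Fin M → ℝ) (ψ : Fin M → ((V → ZMod 2) → ℂ)),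
    (∀ i, 0 ≤ p i) ∧ (∑ i, p i) = 1 ∧ (∀ i, IsUnit' (ψ i)) ∧
    (∀ i, ∃ S : Finset (Fin m), S.Nonempty ∧ S ≠ univ ∧ IsProdVec (S.biUnion P) (ψ i)) ∧
    ρ = ∑ i, (p i : ℂ) • vecMulVec (ψ i) (star (ψ i))

/-- An `m`-separable density matrix: a convex mixture of unit vectors each of which is
fully separable with respect to some partition of `V` into `m` nonempty parts. -/
def MSep (m : ℕ) (ρ : Matrix (V → ZMod 2) (V → ZMod 2) ℂ) : Prop :=
  ∃ (M : ℕ) (p : Fin M → ℝ) (ψ : Fin M → ((V → ZMod 2) → ℂ)),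
    (∀ i, 0 ≤ p i) ∧ (∑ i, p i) = 1 ∧ (∀ i, IsUnit' (ψ i)) ∧
    (∀ i, ∃ P : Fin m → Finset V, IsPartition P ∧ FullSepPure P (ψ i)) ∧
    ρ = ∑ i, (p i : ℂ) • vecMulVec (ψ i) (star (ψ i))

/-- A proper `k`-coloring of `G` with color classes `C 0, …, C (k-1)`:
the classes are disjoint, cover `V`, and each is an independent set. -/
def IsColoring (G : SimpleGraph V) {k : ℕ} (C : Fin k → Finset V) : Prop :=
  (∀ l l', l ≠ l' → Disjoint (C l) (C l')) ∧ univ.biUnion C = univ ∧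
    ∀ l, ∀ i ∈ C l, ∀ j ∈ C l, ¬ G.Adj i j

/-- A density matrix: Hermitian positive semidefinite with trace 1. -/
def IsDensity (ρ : Matrix (V → ZMod 2) (V → ZMod 2) ℂ) : Prop :=
  ρ.PosSemidef ∧ ρ.trace = 1

/-- Glue `a : A → ZMod 2` and `b : Ā → ZMod 2` into a function on `V`. -/
def glue (A : Finset V) (a : {v // v ∈ A} → ZMod 2) (b : {v // v ∉ A} → ZMod 2) :
    V → ZMod 2 := fun v => if h : v ∈ A then a ⟨v, h⟩ else b ⟨v, h⟩

/-- The reduced density matrix `ρ_A` of a pure state `ψ`. -/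
def rdm (A : Finset V) (ψ : (V → ZMod 2) → ℂ) :
    Matrix ({v // v ∈ A} → ZMod 2) ({v // v ∈ A} → ZMod 2) ℂ :=
  Matrix.of fun a a' => ∑ b : {v // v ∉ A} → ZMod 2,
    ψ (glue A a b) * (starRingEnd ℂ) (ψ (glue A a' b))


/-- The star graph on `Fin N` (center `0`, i.e. vertex labelled 1). -/
def starGraph (N : ℕ) : SimpleGraph (Fin N) :=
  SimpleGraph.fromRel (fun i _ => (i : ℕ) = 0)

/-- The path graph on `Fin N` (vertex `v` represents the label `v+1`). -/
def pathGraph (N : ℕ) : SimpleGraph (Fin N) :=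
  SimpleGraph.fromRel (fun a b => (a : ℕ) + 1 = (b : ℕ))

/-- The `n × n` grid graph. -/
def gridGraph (n : ℕ) : SimpleGraph (Fin n × Fin n) :=
  SimpleGraph.fromRel (fun a b => Nat.dist (a.1 : ℕ) (b.1 : ℕ) + Nat.dist (a.2 : ℕ) (b.2 : ℕ) = 1)

/-- The number of edges of `G` crossing the bipartition `{A, V \ A}` (each such edge is
counted once, as the ordered pair whose first component lies in `A`). -/
def crossCount {W : Type} [Fintype W] [DecidableEq W] (G : SimpleGraph W) (A : Finset W) : ℕ :=
  ((univ ×ˢ univ).filter fun p : W × W => G.Adj p.1 p.2 ∧ p.1 ∈ A ∧ p.2 ∉ A).card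

section StarProjection

variable {R : Type*} [Ring R] [StarRing R]

/-- A product of pairwise commuting star projections is a star projection, and it is absorbed
by each of its factors. -/
theorem isStarProjection_list_prod {l : List R} (hp : ∀ p ∈ l, IsStarProjection p)
    (hc : ∀ p ∈ l, ∀ q ∈ l, Commute p q) :
    IsStarProjection l.prod ∧ ∀ q ∈ l, q * l.prod = l.prod := by
  induction l with
  | nil => simp
  | cons a t ih =>
    obtain ⟨ht, ha⟩ := ih (fun p h => hp p (.tail _ h))
      (fun p h q h' => hc p (.tail _ h) q (.tail _ h'))
    have hpa : IsStarProjection a := hp a (.head _)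
    have hcomm : Commute a t.prod :=
      Commute.list_prod_right t a fun q h => hc a (.head _) q (.tail _ h)
    rw [List.prod_cons]
    refine ⟨⟨?_, ?_⟩, fun q hq => ?_⟩
    · exact hpa.isIdempotentElem.mul_of_commute hcomm ht.isIdempotentElem
    · rw [IsSelfAdjoint, star_mul, hpa.isSelfAdjoint.star_eq, ht.isSelfAdjoint.star_eq,
        hcomm.eq]
    · rcases List.mem_cons.1 hq with rfl | h
      · rw [← mul_assoc, hpa.isIdempotentElem.eq]
      · rw [← mul_assoc, (hc q hq a (.head _)).eq, mul_assoc, ha q h]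

/-- If a star projection `q` absorbs a star projection `p`, then `q - p` is a star projection. -/
theorem IsStarProjection.sub_of_mul_eq {p q : R} (hp : IsStarProjection p)
    (hq : IsStarProjection q) (h : q * p = p) : IsStarProjection (q - p) := by
  have h' : p * q = p := by
    simpa [hp.isSelfAdjoint.star_eq, hq.isSelfAdjoint.star_eq] using congrArg star h
  refine ⟨?_, hq.isSelfAdjoint.sub hp.isSelfAdjoint⟩
  rw [IsIdempotentElem, sub_mul, mul_sub, mul_sub, h, h', hp.isIdempotentElem.eq,
    hq.isIdempotentElem.eq]
  abel

end StarProjection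

/-- The quadratic form of a star projection is nonnegative. -/
theorem IsStarProjection.dotProduct_mulVec_nonneg {n : Type*} [Fintype n]
    {M : Matrix n n ℂ} (hM : IsStarProjection M) (ψ : n → ℂ) :
    0 ≤ star ψ ⬝ᵥ (M *ᵥ ψ) := by
  have h : M = Mᴴ * M := by
    rw [← star_eq_conjTranspose, hM.isSelfAdjoint.star_eq, hM.isIdempotentElem.eq]
  rw [h]
  exact (posSemidef_conjTranspose_mul_self M).dotProduct_mulVec_nonneg ψ

theorem add_delta_of_ne {i j : V} (h : j ≠ i) (x : V → ZMod 2) : (x + delta i) j = x j := by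
  simp [delta, h]

theorem add_add_self_zmod_two {ι : Type*} (u d : ι → ZMod 2) : u + d + d = u := by
  funext i
  simp [add_assoc, CharTwo.add_self_eq_zero]

/-- The sign `∏_{j ∈ N(i)} (-1)^{u(j)}`, where `j` ranges over the vertices satisfying `p`. -/
def phase (G : SimpleGraph V) (p : V → Prop) (i : V) (u : {v // p v} → ZMod 2) : ℝ :=
  ∏ j : {v // p v}, if G.Adj i j.1 then (-1) ^ (u j).val else 1

theorem abs_phase (G : SimpleGraph V) (p : V → Prop) (i : V) (u : {v // p v} → ZMod 2) :
    |phase G p i u| = 1 := by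
  rw [phase, Finset.abs_prod]
  refine Finset.prod_eq_one fun j _ => ?_
  split_ifs <;> simp

theorem phase_add_delta (G : SimpleGraph V) (p : V → Prop) {i a : V} (ha : p a)
    (hadj : G.Adj i a) (u : {v // p v} → ZMod 2) :
    phase G p i (u + fun v => delta a v.1) = -phase G p i u := by
  have hz : ∀ z : ZMod 2, (-1 : ℝ) ^ (z + 1).val = (-1) ^ z.val * (-1) := by
    intro z
    fin_cases z
    · change (-1 : ℝ) ^ 1 = (-1) ^ 0 * (-1)
      norm_num
    · change (-1 : ℝ) ^ 0 = (-1) ^ 1 * (-1)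
      norm_num
  have hterm : ∀ j : {v // p v},
      (if G.Adj i j.1 then (-1 : ℝ) ^ ((u + fun v : {v // p v} => delta a v.1) j).val else 1) =
        (if G.Adj i j.1 then (-1) ^ (u j).val else 1) * if j = ⟨a, ha⟩ then -1 else 1 := by
    intro j
    by_cases hj : j = ⟨a, ha⟩
    · subst hj
      simp [hadj, delta, hz]
    · have : j.1 ≠ a := fun h => hj (Subtype.ext h)
      simp [hj, delta, this]
  simp only [phase, hterm]
  rw [Finset.prod_mul_distrib, Finset.prod_ite_eq' univ]
  simp

/-- The sign of the stabilizer at `i` factorizes across a bipartition. -/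
theorem neg_one_pow_eq_phase_mul (G : SimpleGraph V) (A : Finset V) (i : V) (x : V → ZMod 2) :
    (-1 : ℂ) ^ (∑ j ∈ univ.filter (fun j => G.Adj i j), (x j).val) =
      ((phase G (· ∈ A) i (restrictTo A x) * phase G (· ∉ A) i (restrictOut A x) : ℝ) : ℂ) := by
  have h := Fintype.prod_subtype_mul_prod_subtype (· ∈ A)
    (fun j => if G.Adj i j then (-1 : ℝ) ^ (x j).val else 1)
  simp only [phase, restrictTo, restrictOut]
  rw [show (-1 : ℂ) = ((-1 : ℝ) : ℂ) by simp, ← Complex.ofReal_pow,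
    ← Finset.prod_pow_eq_pow_sum, Finset.prod_filter, ← h]
  congr!

theorem stab_mulVec (G : SimpleGraph V) (i : V) (ψ : (V → ZMod 2) → ℂ) (x : V → ZMod 2) :
    (stab G i *ᵥ ψ) x =
      (-1 : ℂ) ^ (∑ j ∈ univ.filter (fun j => G.Adj i j), (x j).val) * ψ (x + delta i) := by
  simp [stab, mulVec, dotProduct]

theorem sum_val_add_delta (G : SimpleGraph V) {i j : V} (h : ¬ G.Adj i j) (x : V → ZMod 2) :
    ∑ v ∈ univ.filter (fun v => G.Adj i v), ((x + delta j) v).val =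
      ∑ v ∈ univ.filter (fun v => G.Adj i v), (x v).val := by
  refine Finset.sum_congr rfl fun v hv => ?_
  rw [add_delta_of_ne]
  rintro rfl
  exact h (Finset.mem_filter.1 hv).2

theorem stab_mul_self (G : SimpleGraph V) (i : V) : stab G i * stab G i = 1 := by
  refine ext_of_mulVec_single fun y => funext fun x => ?_
  rw [← mulVec_mulVec, stab_mulVec, stab_mulVec, sum_val_add_delta G (G.loopless.irrefl i),
    add_add_self_zmod_two, ← mul_assoc, ← mul_pow, one_mulVec]
  simp

theorem stab_commute (G : SimpleGraph V) {i j : V} (h : ¬ G.Adj i j) :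
    Commute (stab G i) (stab G j) := by
  refine ext_of_mulVec_single fun y => funext fun x => ?_
  simp only [← mulVec_mulVec, stab_mulVec]
  rw [sum_val_add_delta G h, sum_val_add_delta G (fun h' => h h'.symm), add_right_comm]
  ring

theorem stab_isSelfAdjoint (G : SimpleGraph V) (i : V) : IsSelfAdjoint (stab G i) := by
  ext x y
  rw [star_apply]
  by_cases h : y = x + delta i
  · subst h
    rw [stab, of_apply, of_apply, sum_val_add_delta G (G.loopless.irrefl i)]
    simp [add_add_self_zmod_two]
  · have h' : x ≠ y + delta i := by
      rintro rfl
      exact h (add_add_self_zmod_two y (delta i)).symm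
    simp [stab, h, h']

theorem isStarProjection_half_stab (G : SimpleGraph V) (i : V) :
    IsStarProjection ((2 : ℂ)⁻¹ • (stab G i + 1)) := by
  constructor
  · rw [IsIdempotentElem, smul_mul_smul_comm, add_mul, mul_add, stab_mul_self]
    simp only [mul_one, one_mul]
    rw [show (1 : Matrix (V → ZMod 2) (V → ZMod 2) ℂ) + stab G i + (stab G i + 1) =
      (2 : ℂ) • (stab G i + 1) by rw [two_smul]; abel, smul_smul]
    norm_num
  · rw [IsSelfAdjoint, star_smul, star_add, (stab_isSelfAdjoint G i).star_eq, star_one]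
    simp

theorem stabProj_spec (G : SimpleGraph V) {W : Finset V}
    (hW : ∀ i ∈ W, ∀ j ∈ W, ¬ G.Adj i j) :
    IsStarProjection (stabProj G W) ∧
      ∀ i ∈ W, ((2 : ℂ)⁻¹ • (stab G i + 1)) * stabProj G W = stabProj G W := by
  have h := isStarProjection_list_prod
    (l := W.toList.map (fun i => (2 : ℂ)⁻¹ • (stab G i + 1))) ?_ ?_
  · refine ⟨h.1, fun i hi => h.2 _ (List.mem_map_of_mem (Finset.mem_toList.2 hi))⟩
  · intro p hp
    obtain ⟨i, -, rfl⟩ := List.mem_map.1 hp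
    exact isStarProjection_half_stab G i
  · intro p hp q hq
    obtain ⟨i, hi, rfl⟩ := List.mem_map.1 hp
    obtain ⟨j, hj, rfl⟩ := List.mem_map.1 hq
    have hc := stab_commute G (hW i (Finset.mem_toList.1 hi) j (Finset.mem_toList.1 hj))
    exact ((hc.add_left (Commute.one_left _)).add_right (Commute.one_right _)).smul_left _
      |>.smul_right _

/-- The expectation values of an anticommuting pair of a shift `σ` and a diagonal sign `t`
satisfy an uncertainty relation. -/
theorem sq_add_sq_le_of_anticommute {U : Type*} [Fintype U] {σ : U → U}
    (hσ : Function.Involutive σ) {t : U → ℝ} (ht : ∀ u, |t u| = 1)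
    (htσ : ∀ u, t (σ u) = -t u) (f : U → ℝ) :
    (∑ u, f u * f (σ u)) ^ 2 + (∑ u, t u * f u ^ 2) ^ 2 ≤ (∑ u, f u ^ 2) ^ 2 := by
  have hsum : ∀ g : U → ℝ, ∑ u, g (σ u) = ∑ u, g u := fun g =>
    Equiv.sum_comp hσ.toPerm g
  have hw : ∀ u, 0 ≤ 1 + t u := fun u => by
    linarith [neg_abs_le (t u), ht u]
  have hcross : ∑ u, t u * (f u * f (σ u)) = 0 := by
    have h := hsum fun u => t u * (f u * f (σ u))
    simp only [htσ, hσ _, neg_mul, Finset.sum_neg_distrib] at h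
    simp only [mul_comm (f (σ _))] at h
    linarith
  have hplus : ∑ u, (1 + t u) * f u ^ 2 = ∑ u, f u ^ 2 + ∑ u, t u * f u ^ 2 := by
    simp only [add_mul, one_mul, Finset.sum_add_distrib]
  have hminus : ∑ u, (1 + t u) * f (σ u) ^ 2 = ∑ u, f u ^ 2 - ∑ u, t u * f u ^ 2 := by
    have h := hsum fun u => (1 - t u) * f u ^ 2
    simp only [htσ, sub_neg_eq_add] at h
    rw [h]
    simp only [sub_mul, one_mul, Finset.sum_sub_distrib]
  have hmid : ∑ u, (1 + t u) * (f u * f (σ u)) = ∑ u, f u * f (σ u) := by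
    simp only [add_mul, one_mul, Finset.sum_add_distrib, hcross, add_zero]
  have hcs := Finset.sum_sq_le_sum_mul_sum_of_sq_le_mul univ
    (r := fun u => (1 + t u) * (f u * f (σ u))) (f := fun u => (1 + t u) * f u ^ 2)
    (g := fun u => (1 + t u) * f (σ u) ^ 2)
    (fun u _ => mul_nonneg (hw u) (sq_nonneg _)) (fun u _ => mul_nonneg (hw u) (sq_nonneg _))
    (fun u _ => le_of_eq (by ring))
  rw [hplus, hminus, hmid] at hcs
  linarith

/-- Bound on the expectation value of a product operator in a product vector, where the first
factor is a signed shift `σ` and the second factor is a diagonal operator `s₂`. -/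
theorem norm_sum_le_of_product {X U W : Type*} [Fintype X] [Fintype U] [Fintype W]
    (e : X ≃ U × W) {τ : X → X} {σ : U → U} (hτ : ∀ x, e (τ x) = (σ (e x).1, (e x).2))
    {s₁ : U → ℝ} (hs₁ : ∀ u, |s₁ u| = 1) (s₂ : W → ℝ) {ψ : X → ℂ} {φ : U → ℂ} {χ : W → ℂ}
    (hψ : ∀ x, ψ x = φ (e x).1 * χ (e x).2) :
    ‖∑ x, star (ψ x) * (((s₁ (e x).1 * s₂ (e x).2 : ℝ) : ℂ) * ψ (τ x))‖ ≤
      (∑ u, ‖φ u‖ * ‖φ (σ u)‖) * |∑ w, s₂ w * ‖χ w‖ ^ 2| := by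
  have h : ∑ x, star (ψ x) * (((s₁ (e x).1 * s₂ (e x).2 : ℝ) : ℂ) * ψ (τ x)) =
      (∑ u, star (φ u) * s₁ u * φ (σ u)) * ((∑ w, s₂ w * ‖χ w‖ ^ 2 : ℝ) : ℂ) := by
    rw [Complex.ofReal_sum, Finset.sum_mul_sum, ← Fintype.sum_prod_type',
      ← Equiv.sum_comp e]
    refine Finset.sum_congr rfl fun x _ => ?_
    rw [hψ, hψ, hτ]
    have hn : ((‖χ (e x).2‖ : ℂ)) ^ 2 = star (χ (e x).2) * χ (e x).2 :=
      (Complex.conj_mul' _).symm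
    push_cast
    rw [hn, star_mul']
    ring
  rw [h, norm_mul, Complex.norm_real, Real.norm_eq_abs]
  refine mul_le_mul_of_nonneg_right ((norm_sum_le _ _).trans (le_of_eq ?_)) (abs_nonneg _)
  refine Finset.sum_congr rfl fun u _ => ?_
  simp [hs₁]

/-- For a unit vector that is a product across `{A, V \ A}`, the stabilizers at the ends of an
edge crossing the bipartition have expectation values summing to at most `1`. -/
theorem re_stab_add_re_stab_le_one (G : SimpleGraph V) {A : Finset V} {a b : V} (ha : a ∈ A)
    (hb : b ∉ A) (hab : G.Adj a b) {ψ : (V → ZMod 2) → ℂ} (hψ : IsUnit' ψ)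
    (hprod : IsProdVec A ψ) :
    (star ψ ⬝ᵥ (stab G a *ᵥ ψ)).re + (star ψ ⬝ᵥ (stab G b *ᵥ ψ)).re ≤ 1 := by
  obtain ⟨φ, χ, hφχ⟩ := hprod
  let e := Equiv.piEquivPiSubtypeProd (· ∈ A) (fun _ : V => ZMod 2)
  let σ : ({v // v ∈ A} → ZMod 2) → ({v // v ∈ A} → ZMod 2) := fun u => u + fun v => delta a v.1
  let τ : ({v // v ∉ A} → ZMod 2) → ({v // v ∉ A} → ZMod 2) := fun w => w + fun v => delta b v.1
  have hσ : Function.Involutive σ := fun u => add_add_self_zmod_two u _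
  have hτ : Function.Involutive τ := fun w => add_add_self_zmod_two w _
  have hA := sq_add_sq_le_of_anticommute hσ (abs_phase G (· ∈ A) b)
    (phase_add_delta G (· ∈ A) ha hab.symm) (fun u => ‖φ u‖)
  have hB := sq_add_sq_le_of_anticommute hτ (abs_phase G (· ∉ A) a)
    (phase_add_delta G (· ∉ A) hb hab) (fun w => ‖χ w‖)
  have hnorm : (∑ u, ‖φ u‖ ^ 2) * ∑ w, ‖χ w‖ ^ 2 = 1 := by
    have h : ((∑ x, ‖ψ x‖ ^ 2 : ℝ) : ℂ) = 1 := by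
      rw [← hψ, dotProduct]
      push_cast
      exact Finset.sum_congr rfl fun x _ => (Complex.conj_mul' _).symm
    have h' : ∑ x, ‖ψ x‖ ^ 2 = 1 := by exact_mod_cast h
    rw [← h', Finset.sum_mul_sum, ← Fintype.sum_prod_type', ← Equiv.sum_comp e]
    refine Finset.sum_congr rfl fun x _ => ?_
    rw [hφχ, norm_mul, mul_pow]
    rfl
  have hea : ‖star ψ ⬝ᵥ (stab G a *ᵥ ψ)‖ ≤
      (∑ u, ‖φ u‖ * ‖φ (σ u)‖) * |∑ w, phase G (· ∉ A) a w * ‖χ w‖ ^ 2| := by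
    have h := norm_sum_le_of_product e (τ := fun x => x + delta a) (σ := σ) (ψ := ψ) (φ := φ)
      (χ := χ) (fun x => Prod.ext rfl (funext fun v =>
        add_delta_of_ne (fun h : v.1 = a => v.2 (h ▸ ha)) x))
      (abs_phase G (· ∈ A) a) (phase G (· ∉ A) a) hφχ
    simp only [dotProduct, stab_mulVec, neg_one_pow_eq_phase_mul G A]
    exact h
  have heb : ‖star ψ ⬝ᵥ (stab G b *ᵥ ψ)‖ ≤
      (∑ w, ‖χ w‖ * ‖χ (τ w)‖) * |∑ u, phase G (· ∈ A) b u * ‖φ u‖ ^ 2| := by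
    have h := norm_sum_le_of_product (e.trans (Equiv.prodComm _ _)) (τ := fun x => x + delta b)
      (σ := τ) (ψ := ψ) (φ := χ) (χ := φ) (fun x => Prod.ext rfl (funext fun v =>
        add_delta_of_ne (fun h : v.1 = b => hb (h ▸ v.2)) x))
      (abs_phase G (· ∉ A) b) (phase G (· ∈ A) b)
      (fun x => (hφχ x).trans (mul_comm _ _))
    simp only [dotProduct, stab_mulVec, neg_one_pow_eq_phase_mul G A,
      mul_comm (phase G (· ∈ A) b (restrictTo A _))]
    exact h
  have hra := (Complex.re_le_norm _).trans hea
  have hrb := (Complex.re_le_norm _).trans heb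
  refine (add_le_add hra hrb).trans ?_
  change (∑ u, ‖φ u‖ * ‖φ (σ u)‖) ^ 2 + (∑ u, phase G (· ∈ A) b u * ‖φ u‖ ^ 2) ^ 2 ≤
    (∑ u, ‖φ u‖ ^ 2) ^ 2 at hA
  change (∑ w, ‖χ w‖ * ‖χ (τ w)‖) ^ 2 + (∑ w, phase G (· ∉ A) a w * ‖χ w‖ ^ 2) ^ 2 ≤
    (∑ w, ‖χ w‖ ^ 2) ^ 2 at hB
  generalize (∑ u, ‖φ u‖ * ‖φ (σ u)‖) = α at *
  generalize (∑ w, ‖χ w‖ * ‖χ (τ w)‖) = α' at *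
  generalize (∑ u, phase G (· ∈ A) b u * ‖φ u‖ ^ 2) = β at *
  generalize (∑ w, phase G (· ∉ A) a w * ‖χ w‖ ^ 2) = β' at *
  generalize (∑ u, ‖φ u‖ ^ 2) = m at *
  generalize (∑ w, ‖χ w‖ ^ 2) = n at *
  refine le_of_sq_le_sq ?_ zero_le_one
  calc (α * |β'| + α' * |β|) ^ 2 ≤ (α ^ 2 + |β| ^ 2) * (α' ^ 2 + |β'| ^ 2) := by
        nlinarith [sq_nonneg (α * α' - |β| * |β'|)]
    _ ≤ m ^ 2 * n ^ 2 := by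
        rw [sq_abs, sq_abs]
        gcongr
    _ = 1 ^ 2 := by rw [← mul_pow, hnorm]

/-- A connected graph has an edge crossing every nontrivial bipartition. -/
theorem exists_adj_mem_notMem (G : SimpleGraph V) (hconn : G.Connected) {A : Finset V}
    (hA : A.Nonempty) (hA' : A ≠ univ) : ∃ a ∈ A, ∃ b ∉ A, G.Adj a b := by
  obtain ⟨u, hu⟩ := hA
  obtain ⟨v, hv⟩ : ∃ v, v ∉ A := by
    by_contra! h
    exact hA' (Finset.eq_univ_iff_forall.2 h)
  obtain ⟨p⟩ := hconn.preconnected u v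
  obtain ⟨d, -, h₁, h₂⟩ := p.exists_boundary_dart (A : Set V) hu hv
  exact ⟨d.fst, h₁, d.snd, h₂, d.adj⟩

theorem sum_re_stabProj_le (G : SimpleGraph V) (hconn : G.Connected) {k : ℕ}
    (C : Fin k → Finset V) (hC : IsColoring G C) {A : Finset V} (hA : A.Nonempty)
    (hA' : A ≠ univ) {ψ : (V → ZMod 2) → ℂ} (hψ : IsUnit' ψ) (hprod : IsProdVec A ψ) :
    ∑ l, (star ψ ⬝ᵥ (stabProj G (C l) *ᵥ ψ)).re ≤ (k : ℝ) - 1 / 2 := by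
  obtain ⟨a, ha, b, hb, hab⟩ := exists_adj_mem_notMem G hconn hA hA'
  obtain ⟨-, hcover, hind⟩ := hC
  have hmem : ∀ v, ∃ l, v ∈ C l := fun v => by
    simpa using Finset.eq_univ_iff_forall.1 hcover v
  obtain ⟨l, hl⟩ := hmem a
  obtain ⟨m, hm⟩ := hmem b
  have hlm : l ≠ m := by
    rintro rfl
    exact hind l a hl b hm hab
  have hle_one : ∀ i, (star ψ ⬝ᵥ (stabProj G (C i) *ᵥ ψ)).re ≤ 1 := fun i => by
    have h := ((stabProj_spec G (hind i)).1.one_sub).dotProduct_mulVec_nonneg ψ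
    rw [sub_mulVec, one_mulVec, dotProduct_sub, hψ] at h
    simpa using (Complex.le_def.1 h).1
  have hle_stab : ∀ i, ∀ v ∈ C i, (star ψ ⬝ᵥ (stabProj G (C i) *ᵥ ψ)).re ≤
      (1 + (star ψ ⬝ᵥ (stab G v *ᵥ ψ)).re) / 2 := fun i v hv => by
    have hP := stabProj_spec G (hind i)
    have h := (hP.1.sub_of_mul_eq (isStarProjection_half_stab G v)
      (hP.2 v hv)).dotProduct_mulVec_nonneg ψ
    rw [sub_mulVec, smul_mulVec, add_mulVec, one_mulVec, dotProduct_sub, dotProduct_smul,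
      dotProduct_add, hψ, smul_eq_mul] at h
    have h' := (Complex.le_def.1 h).1
    rw [show (2 : ℂ)⁻¹ = ((2⁻¹ : ℝ) : ℂ) by push_cast; rfl, Complex.sub_re,
      Complex.re_ofReal_mul, Complex.add_re] at h'
    simp only [Complex.zero_re, Complex.one_re] at h'
    linarith
  have hpair := re_stab_add_re_stab_le_one G ha hb hab hψ hprod
  have hla := hle_stab l a hl
  have hmb := hle_stab m b hm
  have hslack : ∑ i ∈ {l, m}, (1 - (star ψ ⬝ᵥ (stabProj G (C i) *ᵥ ψ)).re) ≤
      ∑ i, (1 - (star ψ ⬝ᵥ (stabProj G (C i) *ᵥ ψ)).re) :=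
    Finset.sum_le_sum_of_subset_of_nonneg (Finset.subset_univ _)
      fun i _ _ => sub_nonneg.2 (hle_one i)
  rw [Finset.sum_pair hlm, Finset.sum_sub_distrib] at hslack
  simp only [Finset.sum_const, Finset.card_univ, Fintype.card_fin, nsmul_eq_mul, mul_one]
    at hslack
  linarith

/-- Corollary 1: for a connected graph `G` on `N ≥ 2` vertices with a proper `k`-coloring
`C` and projectors `P_l = ∏_{i ∈ C l} (S_i + I)/2`, every bi-separable density matrix `ρ`
(a convex mixture of unit vectors, each a product vector across `{A, V \ A}` for some
nonempty proper subset `A ⊆ V`) satisfies `∑_l Tr(P_l ρ) ≤ k - 1/2`. -/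
theorem witness_genuine (G : SimpleGraph V) (hconn : G.Connected)
    (hN : 2 ≤ Fintype.card V) {k : ℕ} (C : Fin k → Finset V) (hC : IsColoring G C)
    (ρ : Matrix (V → ZMod 2) (V → ZMod 2) ℂ) (hρd : IsDensity ρ)
    (hρ : ∃ (M : ℕ) (p : Fin M → ℝ) (ψ : Fin M → ((V → ZMod 2) → ℂ)),
      (∀ i, 0 ≤ p i) ∧ (∑ i, p i) = 1 ∧ (∀ i, IsUnit' (ψ i)) ∧
      (∀ i, ∃ A : Finset V, A.Nonempty ∧ A ≠ univ ∧ IsProdVec A (ψ i)) ∧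
      ρ = ∑ i, (p i : ℂ) • vecMulVec (ψ i) (star (ψ i))) :
    ∑ l, (stabProj G (C l) * ρ).trace ≤ (((k : ℝ) - 1/2 : ℝ) : ℂ) := by
  obtain ⟨M, p, ψ, hp, hp1, hψ, hprod, rfl⟩ := hρ
  have hreal : ∀ l i, star (ψ i) ⬝ᵥ (stabProj G (C l) *ᵥ ψ i) =
      ((star (ψ i) ⬝ᵥ (stabProj G (C l) *ᵥ ψ i)).re : ℂ) := fun l i =>
    Complex.eq_re_of_ofReal_le (r := 0) <| by
      simpa using (stabProj_spec G (hC.2.2 l)).1.dotProduct_mulVec_nonneg (ψ i)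
  have htrace : ∑ l, (stabProj G (C l) *
      ∑ i, (p i : ℂ) • vecMulVec (ψ i) (star (ψ i))).trace =
      ((∑ i, p i * ∑ l, (star (ψ i) ⬝ᵥ (stabProj G (C l) *ᵥ ψ i)).re : ℝ) : ℂ) := by
    push_cast
    simp only [← hreal, Finset.mul_sum, trace_sum, Matrix.mul_smul, trace_smul, mul_vecMulVec,
      trace_vecMulVec, smul_eq_mul]
    rw [Finset.sum_comm]
    simp only [dotProduct_comm (star _)]
  rw [htrace, Complex.real_le_real]
  calc ∑ i, p i * ∑ l, (star (ψ i) ⬝ᵥ (stabProj G (C l) *ᵥ ψ i)).re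
      ≤ ∑ i, p i * ((k : ℝ) - 1 / 2) := by
        refine Finset.sum_le_sum fun i _ => mul_le_mul_of_nonneg_left ?_ (hp i)
        obtain ⟨A, hA, hA', hAψ⟩ := hprod i
        exact sum_re_stabProj_le G hconn C hC hA hA' (hψ i) hAψ
    _ = (k : ℝ) - 1 / 2 := by rw [← Finset.sum_mul, hp1, one_mul]
end
end

section
/- For the n × n grid graph (n ≥ 1, N = n²), the maximum of r(A) over all nonempty proper subsets A of the vertex set equals ⌊N/2⌋. (This is the key optimization in Corollary 2 for the 2-D cluster state: the maximal bipartite entanglement entropy of the n × n cluster state is ⌊N/2⌋.) -/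
open Matrix Finset
open scoped Classical ComplexOrder

noncomputable section

variable {V : Type} [Fintype V] [DecidableEq V]

lemma gRank_le_card (G : SimpleGraph V) (A : Finset V) : gRank G A ≤ A.card := by
  simpa [gRank] using (gammaMat G A).rank_le_card_height

lemma gRank_le_card_compl (G : SimpleGraph V) (A : Finset V) :
    gRank G A ≤ Fintype.card V - A.card := by
  have h := (gammaMat G A).rank_le_card_width
  rwa [Fintype.card_subtype_compl, Fintype.card_coe] at h

lemma gRank_le_half (G : SimpleGraph V) (A : Finset V) : gRank G A ≤ Fintype.card V / 2 := by
  have h₁ := gRank_le_card G A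
  have h₂ := gRank_le_card_compl G A
  omega

/-- If `A` is matched into its complement by `p` and the matching is triangular with respect
to a weight `w`, then `Γ_{A,Ā}` has full row rank. -/
lemma gRank_eq_card_of_triangular (G : SimpleGraph V) (A : Finset V) (p : V → V) (w : V → ℕ)
    (hp : ∀ a ∈ A, p a ∉ A) (hadj : ∀ a ∈ A, G.Adj a (p a))
    (htri : ∀ a ∈ A, ∀ b ∈ A, G.Adj b (p a) → b ≠ a → w b < w a) :
    gRank G A = A.card := by
  suffices h : LinearIndependent (ZMod 2) (gammaMat G A).row by
    simpa [gRank] using h.rank_matrix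
  rw [Fintype.linearIndependent_iff]
  intro x hx
  suffices h : ∀ (k : ℕ) (a : {v // v ∈ A}), w a = k → x a = 0 from fun a => h _ a rfl
  intro k
  induction k using Nat.strong_induction_on with
  | _ k ih =>
    intro a ha
    have h := congrFun hx ⟨p a, hp a a.2⟩
    rw [Finset.sum_apply, Finset.sum_eq_single a] at h
    · simpa [gammaMat, hadj a a.2] using h
    · intro b _ hba
      by_cases hb : G.Adj b (p a)
      · have hlt := htri a a.2 b b.2 hb (fun e => hba (Subtype.ext e))
        simp [ih _ (ha ▸ hlt) b rfl]
      · simp [gammaMat, hb]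
    · simp

lemma gridGraph_adj {n : ℕ} (a b : Fin n × Fin n) :
    (gridGraph n).Adj a b ↔
      Nat.dist (a.1 : ℕ) (b.1 : ℕ) + Nat.dist (a.2 : ℕ) (b.2 : ℕ) = 1 := by
  simp only [gridGraph, SimpleGraph.fromRel_adj, Nat.dist_comm (b.1 : ℕ), Nat.dist_comm (b.2 : ℕ),
    or_self, and_iff_right_iff_imp]
  rintro h rfl
  simp at h

/-- The vertices in rows of even index, except that in a last row of even index only the
vertices in columns of even index, the last column excluded, are kept. -/
def gridHalf (n : ℕ) : Finset (Fin n × Fin n) :=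
  univ.filter fun v => (v.1 : ℕ) % 2 = 0 ∧
    ((v.1 : ℕ) + 1 < n ∨ ((v.2 : ℕ) % 2 = 0 ∧ (v.2 : ℕ) + 1 < n))

/-- The neighbour below a vertex, or the neighbour to the right of a vertex in the last row. -/
def gridPartner (n : ℕ) (v : Fin n × Fin n) : Fin n × Fin n :=
  if h : (v.1 : ℕ) + 1 < n then (⟨v.1 + 1, h⟩, v.2)
  else if h' : (v.2 : ℕ) + 1 < n then (v.1, ⟨v.2 + 1, h'⟩)
  else v

lemma gRank_gridHalf (n : ℕ) : gRank (gridGraph n) (gridHalf n) = (gridHalf n).card := by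
  refine gRank_eq_card_of_triangular _ _ (gridPartner n) (fun v => 2 * n - v.1 - v.2) ?_ ?_ ?_
  · rintro ⟨i, j⟩ h
    simp only [gridHalf, mem_filter, mem_univ, true_and, gridPartner] at h ⊢
    split_ifs <;> simp only at * <;> omega
  · rintro ⟨i, j⟩ h
    simp only [gridHalf, mem_filter, mem_univ, true_and, gridPartner, gridGraph_adj,
      Nat.dist] at h ⊢
    split_ifs <;> simp only at * <;> omega
  · rintro ⟨i, j⟩ h ⟨k, l⟩ h' hadj hne
    simp only [gridHalf, mem_filter, mem_univ, true_and, gridPartner, gridGraph_adj,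
      Nat.dist, ne_eq, Prod.mk.injEq, Fin.ext_iff] at h h' hadj hne ⊢
    split_ifs at hadj <;> simp only at * <;> omega

lemma card_compl_gridHalf_le (n : ℕ) : (gridHalf n)ᶜ.card ≤ (gridHalf n).card + 1 := by
  rcases n with _ | n
  · simp [Finset.eq_empty_of_isEmpty]
  have hsub : (gridHalf (n + 1))ᶜ ⊆
      insert (Fin.last n, Fin.last n) ((gridHalf (n + 1)).image (gridPartner (n + 1))) := by
    rintro ⟨i, j⟩ h
    simp only [gridHalf, mem_compl, mem_filter, mem_univ, true_and, mem_insert, mem_image,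
      Prod.mk.injEq, Fin.ext_iff, Fin.val_last] at h ⊢
    by_cases hi : (i : ℕ) % 2 = 0
    · by_cases hj : (j : ℕ) % 2 = 0
      · left; omega
      · refine Or.inr ⟨(i, ⟨j - 1, by omega⟩), by simp only; omega, ?_⟩
        rw [gridPartner, dif_neg (by simp only; omega), dif_pos (by simp only; omega)]
        simp only [Prod.mk.injEq, Fin.ext_iff]
        exact ⟨trivial, by omega⟩
    · refine Or.inr ⟨(⟨i - 1, by omega⟩, j), by simp only; omega, ?_⟩
      rw [gridPartner, dif_pos (by simp only; omega)]
      simp only [Prod.mk.injEq, Fin.ext_iff]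
      exact ⟨by omega, trivial⟩
  exact (card_le_card hsub).trans ((card_insert_le _ _).trans
    (Nat.add_le_add_right card_image_le 1))

lemma card_gridHalf (n : ℕ) : (gridHalf n).card = n ^ 2 / 2 := by
  have h₁ := gRank_le_half (gridGraph n) (gridHalf n)
  have h₂ := card_compl_gridHalf_le n
  have h₃ := card_add_card_compl (gridHalf n)
  rw [gRank_gridHalf] at h₁
  have h₄ : Fintype.card (Fin n × Fin n) = n ^ 2 := by simp [sq]
  omega

/-- For the `n × n` grid graph (`n ≥ 1`, `N = n²`), the maximum of `r(A)` over all
nonempty proper subsets `A` of the vertex set equals `⌊N/2⌋`: the maximal bipartite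
entanglement entropy of the `n × n` cluster state is `⌊N/2⌋`. -/
theorem gridGraph_max_gRank (n : ℕ) (hn : 1 ≤ n) :
    sSup {r : ℕ | ∃ A : Finset (Fin n × Fin n),
        A.Nonempty ∧ A ≠ univ ∧ gRank (gridGraph n) A = r} = n ^ 2 / 2 := by
  apply le_antisymm
  · refine csSup_le' ?_
    rintro r ⟨A, -, -, rfl⟩
    simpa [sq] using gRank_le_half (gridGraph n) A
  · rcases hn.eq_or_lt with rfl | hn
    · simp
    have hsq : 2 * 2 ≤ n ^ 2 := by nlinarith
    refine le_csSup ⟨n ^ 2 / 2, ?_⟩ ⟨gridHalf n, ?_, ?_, ?_⟩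
    · rintro r ⟨A, -, -, rfl⟩
      simpa [sq] using gRank_le_half (gridGraph n) A
    · rw [← card_pos, card_gridHalf]
      omega
    · intro h
      have hc := card_gridHalf n
      rw [h, card_univ, Fintype.card_prod, Fintype.card_fin, ← sq] at hc
      omega
    · rw [gRank_gridHalf, card_gridHalf]
end
end

section
/- (Supplementary Lemma 1.) Let A be a nonempty proper subset of the vertex set {1, …, N} of the path graph, and call an edge {i, i+1} a boundary if exactly one of its endpoints lies in A. If the number of boundaries is at least m − 1, then r(A) ≥ ⌊m/2⌋. (Since the bipartite entanglement entropy of the 1-D cluster state across {A, Ā} equals r(A), this says that entanglement entropy across a cut with at least m − 1 boundaries is at least ⌊m/2⌋.) -/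
open Matrix Finset
open scoped Classical ComplexOrder

noncomputable section

variable {V : Type} [Fintype V] [DecidableEq V]

/-- A matching `S` of crossing edges whose biadjacency matrix is triangular for the order
given by `k` bounds `gRank` from below. -/
lemma card_le_gRank_of_triangular (G : SimpleGraph V) (A : Finset V) (S : Finset (V × V))
    (k : V → ℤ) (hS : ∀ e ∈ S, G.Adj e.1 e.2 ∧ e.1 ∈ A ∧ e.2 ∉ A)
    (hk : ∀ e ∈ S, ∀ e' ∈ S, k e.1 = k e'.1 → e = e')
    (htri : ∀ e ∈ S, ∀ e' ∈ S, k e'.1 < k e.1 → ¬ G.Adj e.1 e'.2) :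
    S.card ≤ gRank G A := by
  let : LinearOrder S := LinearOrder.lift' (fun e : S => k e.1.1)
    fun e e' h => Subtype.ext (hk e.1 e.2 e'.1 e'.2 h)
  set M : Matrix S S (ZMod 2) := (gammaMat G A).submatrix
    (fun e => ⟨e.1.1, (hS e.1 e.2).2.1⟩) (fun e => ⟨e.1.2, (hS e.1 e.2).2.2⟩) with hM
  have hdet : M.det = 1 := by
    rw [det_of_isUpperTriangular (M := M)]
    · exact Finset.prod_eq_one fun e _ => by simp [hM, gammaMat, (hS e.1 e.2).1]
    · intro e e' h
      simp [hM, gammaMat, htri e.1 e.2 e'.1 e'.2 h]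
  have hunit : IsUnit M := by
    rw [isUnit_iff_isUnit_det, hdet]
    exact isUnit_one
  calc S.card = Fintype.card S := (Fintype.card_coe S).symm
    _ = M.rank := (rank_of_isUnit M hunit).symm
    _ ≤ gRank G A := rank_submatrix_le _ _ _

lemma pathGraph_adj_iff {N : ℕ} (a b : Fin N) :
    (pathGraph N).Adj a b ↔ (a : ℕ) + 1 = b ∨ (b : ℕ) + 1 = a := by
  simp only [pathGraph, SimpleGraph.fromRel_adj, ne_eq, Fin.ext_iff]
  omega

/-- Crossing edges all leaving `A` in the same direction along the path have triangular
biadjacency matrix, and one of the two directions accounts for half of the crossing edges. -/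
lemma crossCount_pathGraph_le_two_mul_gRank (N : ℕ) (A : Finset (Fin N)) :
    crossCount (pathGraph N) A ≤ 2 * gRank (pathGraph N) A := by
  set T := (univ ×ˢ univ).filter
    fun p : Fin N × Fin N => (pathGraph N).Adj p.1 p.2 ∧ p.1 ∈ A ∧ p.2 ∉ A with hT
  have hcard := T.card_filter_add_card_filter_not fun p => (p.1 : ℕ) < p.2
  have hright : (T.filter fun p => (p.1 : ℕ) < p.2).card ≤ gRank (pathGraph N) A := by
    apply card_le_gRank_of_triangular _ _ _ fun v : Fin N => -((v : ℕ) : ℤ)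
    all_goals simp only [hT, mem_filter, mem_product, mem_univ, pathGraph_adj_iff,
      Prod.ext_iff, Fin.ext_iff]
    · tauto
    all_goals omega
  have hleft : (T.filter fun p => ¬ (p.1 : ℕ) < p.2).card ≤ gRank (pathGraph N) A := by
    apply card_le_gRank_of_triangular _ _ _ fun v : Fin N => ((v : ℕ) : ℤ)
    all_goals simp only [hT, mem_filter, mem_product, mem_univ, pathGraph_adj_iff,
      Prod.ext_iff, Fin.ext_iff]
    · tauto
    all_goals omega
  have hcross : crossCount (pathGraph N) A = T.card := by
    rw [crossCount, hT]
  omega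

/-- Supplementary Lemma 1: for a nonempty proper subset `A` of the vertices of the path
graph, if the number of boundary edges (edges with exactly one endpoint in `A`) is at
least `m - 1`, then `r(A) ≥ ⌊m/2⌋`. -/
theorem pathGraph_gRank_ge_of_boundaries (N m : ℕ) (A : Finset (Fin N))
    (hA : A.Nonempty) (hA' : A ≠ univ)
    (hb : m - 1 ≤ crossCount (pathGraph N) A) :
    m / 2 ≤ gRank (pathGraph N) A := by
  have h := crossCount_pathGraph_le_two_mul_gRank N A
  omega
end
end

section
/- (Corollary 3.) Let G be the path graph on N vertices with the 2-coloring into odd-labelled vertices V_1 and even-labelled vertices V_2, and let P_1 = ∏_{i ∈ V_1} (S_i + I)/2 and P_2 = ∏_{i ∈ V_2} (S_i + I)/2. Then for every 2 ≤ m ≤ N, every m-separable density matrix ρ satisfies Tr(P_1 ρ) + Tr(P_2 ρ) ≤ 1 + 2^{−⌊m/2⌋}. -/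
open Matrix Finset
open scoped Classical ComplexOrder

noncomputable section

variable {V : Type} [Fintype V] [DecidableEq V]

/-- The sign `(-1) ^ z` of a bit `z`. -/
def bitSign (z : ZMod 2) : ℂ := (-1) ^ z.val

lemma bitSign_add (a b : ZMod 2) : bitSign (a + b) = bitSign a * bitSign b := by
  have h : (a + b).val % 2 = (a.val + b.val) % 2 := by
    rw [ZMod.val_add, Nat.mod_mod]
  rw [bitSign, bitSign, bitSign, ← pow_add, neg_one_pow_eq_pow_mod_two, h,
    ← neg_one_pow_eq_pow_mod_two]

lemma bitSign_mul_self (a : ZMod 2) : bitSign a * bitSign a = 1 := by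
  rw [← bitSign_add, CharTwo.add_self_eq_zero]; simp [bitSign]

lemma star_bitSign (a : ZMod 2) : star (bitSign a) = bitSign a := by simp [bitSign]

lemma norm_bitSign (a : ZMod 2) : ‖bitSign a‖ = 1 := by simp [bitSign]

lemma bitSign_sum {ι : Type*} (s : Finset ι) (f : ι → ZMod 2) :
    bitSign (∑ i ∈ s, f i) = ∏ i ∈ s, bitSign (f i) := by
  induction s using Finset.cons_induction with
  | empty => simp [bitSign]
  | cons a s ha ih => rw [Finset.sum_cons, Finset.prod_cons, bitSign_add, ih]

/-- The sum of the bits of `x` over the neighbours of `i`. -/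
def nbrSum (G : SimpleGraph V) (i : V) (x : V → ZMod 2) : ZMod 2 :=
  ∑ j ∈ univ.filter (fun j => G.Adj i j), x j

omit [DecidableEq V] in
lemma nbrSum_sub (G : SimpleGraph V) (i : V) (x y : V → ZMod 2) :
    nbrSum G i (x - y) = nbrSum G i x - nbrSum G i y := by
  simp [nbrSum]

lemma stab_apply (G : SimpleGraph V) (i : V) (x y : V → ZMod 2) :
    stab G i x y = if y = x + delta i then bitSign (nbrSum G i x) else 0 := by
  have : bitSign (nbrSum G i x) = (-1) ^ ∑ j ∈ univ.filter (fun j => G.Adj i j), (x j).val := by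
    rw [nbrSum, bitSign_sum]
    simp only [bitSign, Finset.prod_pow_eq_pow_sum]
  rw [stab, Matrix.of_apply, this]

/-- `q` is a phase function for `G`: flipping bit `i` changes `q` by the sum of the bits
at the neighbours of `i`. -/
def IsPhase (G : SimpleGraph V) (q : (V → ZMod 2) → ZMod 2) : Prop :=
  ∀ i x, q (x + delta i) = q x + nbrSum G i x

/-- The explicit form of `stabProj G W` in terms of a phase function `q` of `G`. -/
def projMat (q : (V → ZMod 2) → ZMod 2) (W : Finset V) :
    Matrix (V → ZMod 2) (V → ZMod 2) ℂ :=
  Matrix.of fun x y =>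
    if ∀ v, v ∉ W → x v = y v then (2 ^ W.card)⁻¹ * bitSign (q x) * bitSign (q y) else 0

lemma projMat_empty (q : (V → ZMod 2) → ZMod 2) : projMat q ∅ = 1 := by
  ext x y
  by_cases h : x = y
  · subst h; simp [projMat, bitSign_mul_self]
  · have : ¬ ∀ v, x v = y v := fun h' => h (funext h')
    simp [projMat, h, this]

lemma projMat_conjTranspose (q : (V → ZMod 2) → ZMod 2) (W : Finset V) :
    (projMat q W)ᴴ = projMat q W := by
  ext x y
  have : (∀ v, v ∉ W → y v = x v) ↔ (∀ v, v ∉ W → x v = y v) :=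
    forall₂_congr fun _ _ => eq_comm
  simp only [conjTranspose_apply, projMat, Matrix.of_apply, this]
  split_ifs
  · simp only [star_mul', star_bitSign, star_inv₀, star_pow, star_ofNat]; ring
  · simp

omit [Fintype V] in
lemma delta_apply_ne {i v : V} (h : v ≠ i) : delta i v = 0 := by simp [delta, h]

omit [Fintype V] in
lemma delta_apply_self (i : V) : delta i i = 1 := by simp [delta]

lemma half_stab_add_one_mul {G : SimpleGraph V} {q : (V → ZMod 2) → ZMod 2} (hq : IsPhase G q)
    (i : V) (W : Finset V) :
    ((2 : ℂ)⁻¹ • (stab G i + 1)) * projMat q W = projMat q (insert i W) := by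
  ext x y
  have key : (((2 : ℂ)⁻¹ • (stab G i + 1)) * projMat q W) x y
      = 2⁻¹ * (bitSign (nbrSum G i x) * projMat q W (x + delta i) y + projMat q W x y) := by
    rw [Matrix.smul_mul, Matrix.add_mul, Matrix.one_mul]
    simp [Matrix.mul_apply, stab_apply]
  rw [key]
  have hs : bitSign (nbrSum G i x) * bitSign (nbrSum G i x) = 1 := bitSign_mul_self _
  simp only [projMat, Matrix.of_apply, hq i x, bitSign_add]
  by_cases hi : i ∈ W
  · have h1 : (∀ v, v ∉ W → (x + delta i) v = y v) ↔ ∀ v, v ∉ W → x v = y v := by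
      refine forall₂_congr fun v hv => ?_
      rw [Pi.add_apply, delta_apply_ne (by rintro rfl; exact hv hi), add_zero]
    simp only [h1, Finset.insert_eq_of_mem hi]
    split_ifs
    · linear_combination 2⁻¹ * (2 ^ W.card)⁻¹ * bitSign (q x) * bitSign (q y) * hs
    · simp
  · rw [Finset.card_insert_of_notMem hi]
    have h0 : (∀ v, v ∉ W → x v = y v) ↔ (∀ v, v ∉ insert i W → x v = y v) ∧ x i = y i := by
      constructor
      · intro h
        exact ⟨fun v hv => h v fun h' => hv (Finset.mem_insert_of_mem h'), h i hi⟩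
      · rintro ⟨h, h'⟩ v hv
        by_cases hvi : v = i
        · subst hvi; exact h'
        · exact h v (by simp [hvi, hv])
    have h1 : (∀ v, v ∉ W → (x + delta i) v = y v) ↔
        (∀ v, v ∉ insert i W → x v = y v) ∧ x i + 1 = y i := by
      constructor
      · intro h
        refine ⟨fun v hv => ?_, by simpa [delta_apply_self] using h i hi⟩
        have hvi : v ≠ i := by rintro rfl; simp at hv
        simpa [delta_apply_ne hvi] using h v fun h' => hv (Finset.mem_insert_of_mem h')
      · rintro ⟨h, h'⟩ v hv
        by_cases hvi : v = i
        · subst hvi; simpa [delta_apply_self] using h'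
        · simpa [delta_apply_ne hvi] using h v (by simp [hvi, hv])
    have h2 : x i + 1 = y i ↔ ¬ x i = y i := by
      generalize x i = a
      generalize y i = b
      revert a b
      decide
    simp only [h0, h1, h2]
    by_cases h : ∀ v, v ∉ insert i W → x v = y v
    · by_cases h' : x i = y i
      · rw [if_neg fun hc => hc.2 h', if_pos ⟨h, h'⟩, if_pos h, pow_succ, mul_inv]
        ring
      · rw [if_pos ⟨h, h'⟩, if_neg fun hc => h' hc.2, if_pos h, pow_succ, mul_inv]
        linear_combination 2⁻¹ * (2 ^ W.card)⁻¹ * bitSign (q x) * bitSign (q y) * hs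
    · simp only [h, false_and, if_false]
      simp

lemma prod_half_stab_add_one_mul {G : SimpleGraph V} {q : (V → ZMod 2) → ZMod 2}
    (hq : IsPhase G q) (l : List V) (W : Finset V) :
    (l.map (fun i => (2 : ℂ)⁻¹ • (stab G i + 1))).prod * projMat q W
      = projMat q (l.toFinset ∪ W) := by
  induction l with
  | nil => simp
  | cons i l ih =>
    rw [List.map_cons, List.prod_cons, Matrix.mul_assoc, ih, half_stab_add_one_mul hq,
      List.toFinset_cons, Finset.insert_union]

lemma stabProj_eq_projMat {G : SimpleGraph V} {q : (V → ZMod 2) → ZMod 2}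
    (hq : IsPhase G q) (W : Finset V) : stabProj G W = projMat q W := by
  have := prod_half_stab_add_one_mul hq W.toList ∅
  rwa [projMat_empty, Matrix.mul_one, Finset.toList_toFinset, Finset.union_empty] at this

lemma projMat_mul_projMat {G : SimpleGraph V} {q : (V → ZMod 2) → ZMod 2}
    (hq : IsPhase G q) (W W' : Finset V) :
    projMat q W * projMat q W' = projMat q (W ∪ W') := by
  have := prod_half_stab_add_one_mul hq W.toList W'
  rw [Finset.toList_toFinset] at this
  rw [← this, ← stabProj_eq_projMat hq W, stabProj]

lemma quadForm_projMat_univ (q : (V → ZMod 2) → ZMod 2) (ψ : (V → ZMod 2) → ℂ) :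
    star ψ ⬝ᵥ projMat q univ *ᵥ ψ
      = (((2 ^ Fintype.card V)⁻¹ * ‖∑ x, bitSign (q x) * ψ x‖ ^ 2 : ℝ) : ℂ) := by
  push_cast
  rw [← Complex.mul_conj', map_sum, Finset.sum_mul_sum, Finset.mul_sum]
  simp only [dotProduct, Matrix.mulVec, Pi.star_apply, Finset.mul_sum, projMat, Matrix.of_apply]
  rw [Finset.sum_comm]
  refine Finset.sum_congr rfl fun x _ => Finset.sum_congr rfl fun y _ => ?_
  have : (starRingEnd ℂ) (bitSign (q y)) = bitSign (q y) := star_bitSign _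
  simp [this]
  ring

lemma quadForm_add_le {G : SimpleGraph V} {q : (V → ZMod 2) → ZMod 2} (hq : IsPhase G q)
    {W W' : Finset V} (hW : W ∪ W' = univ) {ψ : (V → ZMod 2) → ℂ} (hψ : IsUnit' ψ) :
    star ψ ⬝ᵥ projMat q W *ᵥ ψ + star ψ ⬝ᵥ projMat q W' *ᵥ ψ
      ≤ 1 + star ψ ⬝ᵥ projMat q univ *ᵥ ψ := by
  set Q := 1 - projMat q W - projMat q W' + projMat q univ with hQ
  have hH : Qᴴ = Q := by
    simp [hQ, conjTranspose_add, conjTranspose_sub, projMat_conjTranspose]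
  have hQQ : Qᴴ * Q = Q := by
    rw [hH]
    have hW' : W' ∪ W = univ := by rw [Finset.union_comm, hW]
    simp only [hQ, Matrix.mul_add, Matrix.add_mul, Matrix.mul_sub, Matrix.sub_mul, Matrix.one_mul,
      Matrix.mul_one, projMat_mul_projMat hq, Finset.union_self, hW, hW',
      Finset.union_eq_left.2 (Finset.subset_univ _), Finset.union_eq_right.2 (Finset.subset_univ _)]
    abel
  have h0 : 0 ≤ star ψ ⬝ᵥ Q *ᵥ ψ := by
    have := (posSemidef_conjTranspose_mul_self Q).dotProduct_mulVec_nonneg ψ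
    rwa [hQQ] at this
  have hψ' : star ψ ⬝ᵥ ψ = 1 := hψ
  rw [hQ, Matrix.add_mulVec, Matrix.sub_mulVec, Matrix.sub_mulVec, Matrix.one_mulVec,
    dotProduct_add, dotProduct_sub, dotProduct_sub, hψ'] at h0
  rw [← sub_nonneg]
  convert h0 using 1
  ring

lemma norm_sum_kernel_sq_le {α β : Type*} [Fintype α] [AddCommGroup α] [Fintype β]
    (h : α → β → ℂ) (hh : ∀ a b, ‖h a b‖ ≤ 1) (K : Finset α)
    (hK : ∀ a a', a - a' ∉ K → ∑ b, h a b * star (h a' b) = 0) (φ : α → ℂ) (χ : β → ℂ) :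
    ‖∑ b, ∑ a, h a b * (φ a * χ b)‖ ^ 2
      ≤ Fintype.card β * K.card * (∑ a, ‖φ a‖ ^ 2) * ∑ b, ‖χ b‖ ^ 2 := by
  set w : β → ℂ := fun b => ∑ a, h a b * φ a with hw
  have h1 : ‖∑ b, ∑ a, h a b * (φ a * χ b)‖ ^ 2 ≤ (∑ b, ‖w b‖ ^ 2) * ∑ b, ‖χ b‖ ^ 2 := by
    have : ∑ b, ∑ a, h a b * (φ a * χ b) = ∑ b, w b * χ b := by
      refine Finset.sum_congr rfl fun b _ => ?_
      rw [hw, Finset.sum_mul]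
      exact Finset.sum_congr rfl fun a _ => by ring
    rw [this]
    refine le_trans ?_ (Finset.sum_mul_sq_le_sq_mul_sq univ (fun b => ‖w b‖) fun b => ‖χ b‖)
    refine pow_le_pow_left₀ (norm_nonneg _) ((norm_sum_le _ _).trans ?_) 2
    simp
  have h2 : ((∑ b, ‖w b‖ ^ 2 : ℝ) : ℂ)
      = ∑ a, ∑ a', φ a * star (φ a') * ∑ b, h a b * star (h a' b) := by
    push_cast
    simp only [← Complex.mul_conj', hw, map_sum, Finset.sum_mul_sum]
    simp only [Finset.mul_sum]
    rw [Finset.sum_comm]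
    refine Finset.sum_congr rfl fun a _ => ?_
    rw [Finset.sum_comm]
    refine Finset.sum_congr rfl fun a' _ => Finset.sum_congr rfl fun b _ => ?_
    simp only [map_mul, RCLike.star_def]
    ring
  have h3 : ∀ a a', ‖φ a * star (φ a') * ∑ b, h a b * star (h a' b)‖
      ≤ if a - a' ∈ K then Fintype.card β * ((‖φ a‖ ^ 2 + ‖φ a'‖ ^ 2) / 2) else 0 := by
    intro a a'
    split_ifs with hmem
    · have hb : ‖∑ b, h a b * star (h a' b)‖ ≤ Fintype.card β := by
        refine (norm_sum_le _ _).trans ((Finset.sum_le_card_nsmul univ _ 1 fun b _ => ?_).trans ?_)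
        · rw [norm_mul, norm_star]
          exact mul_le_one₀ (hh a b) (norm_nonneg _) (hh a' b)
        · simp
      rw [norm_mul, norm_mul, norm_star, mul_comm]
      refine mul_le_mul hb ?_ (by positivity) (by positivity)
      nlinarith [sq_nonneg (‖φ a‖ - ‖φ a'‖)]
    · rw [hK a a' hmem, mul_zero, norm_zero]
  have hrow : ∀ a, ∑ a', (if a - a' ∈ K then (1 : ℝ) else 0) = K.card := by
    intro a
    exact (Equiv.sum_comp (Equiv.subLeft a) fun d => if d ∈ K then (1 : ℝ) else 0).trans (by simp)
  have hcol : ∀ a', ∑ a, (if a - a' ∈ K then (1 : ℝ) else 0) = K.card := by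
    intro a'
    exact (Equiv.sum_comp (Equiv.subRight a') fun d => if d ∈ K then (1 : ℝ) else 0).trans (by simp)
  have h4 : ∑ a, ∑ a', (if a - a' ∈ K then
      Fintype.card β * ((‖φ a‖ ^ 2 + ‖φ a'‖ ^ 2) / 2) else 0)
      = Fintype.card β * K.card * ∑ a, ‖φ a‖ ^ 2 := by
    have e : ∀ a a', (if a - a' ∈ K then
        (Fintype.card β : ℝ) * ((‖φ a‖ ^ 2 + ‖φ a'‖ ^ 2) / 2) else 0)
        = Fintype.card β / 2 * (‖φ a‖ ^ 2 * if a - a' ∈ K then (1 : ℝ) else 0)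
          + Fintype.card β / 2 * (‖φ a'‖ ^ 2 * if a - a' ∈ K then (1 : ℝ) else 0) := by
      intro a a'
      split_ifs <;> ring
    simp only [e, Finset.sum_add_distrib]
    rw [Finset.sum_comm (f := fun a a' =>
      (Fintype.card β : ℝ) / 2 * (‖φ a'‖ ^ 2 * if a - a' ∈ K then (1 : ℝ) else 0))]
    simp only [← Finset.mul_sum, hrow, hcol, ← Finset.sum_mul]
    ring
  have h5 : ∑ b, ‖w b‖ ^ 2 ≤ Fintype.card β * K.card * ∑ a, ‖φ a‖ ^ 2 := by
    have hn : ∑ b, ‖w b‖ ^ 2 = ‖((∑ b, ‖w b‖ ^ 2 : ℝ) : ℂ)‖ := by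
      rw [Complex.norm_real, Real.norm_of_nonneg (by positivity)]
    rw [hn, h2, ← h4]
    exact (norm_sum_le _ _).trans (Finset.sum_le_sum fun a _ =>
      (norm_sum_le _ _).trans (Finset.sum_le_sum fun a' _ => h3 a a'))
  exact h1.trans (mul_le_mul_of_nonneg_right h5 (by positivity))

lemma pathGraph_adj {N : ℕ} (i j : Fin N) :
    (pathGraph N).Adj i j ↔ (i : ℕ) + 1 = j ∨ (j : ℕ) + 1 = i := by
  simp only [pathGraph, SimpleGraph.fromRel_adj, and_iff_right_iff_imp]
  rintro h rfl
  omega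

/-- Away from the root, a predicate can alternate along a parent function of decreasing height. -/
lemma exists_alternating {ι : Type*} (ht : ι → ℕ) (root : ι) (parent : ι → ι)
    (hp : ∀ t, t ≠ root → ht (parent t) < ht t) :
    ∃ κ : ι → Prop, ∀ t, t ≠ root → (κ t ↔ ¬ κ (parent t)) := by
  refine ⟨(measure ht).wf.fix fun t ih =>
    if h : t ≠ root then ¬ ih (parent t) (hp t h) else True, fun t h => ?_⟩
  rw [WellFounded.fix_eq]
  simp [h]

/-- Colour classes of a path can be merged into two sides so that half as many pairwise disjoint
edges as there are classes join the two sides. -/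
lemma exists_crossing_matching {N m : ℕ} (hm : 2 ≤ m) {P : Fin m → Finset (Fin N)}
    (hP : IsPartition P) :
    ∃ (S : Finset (Fin m)) (F : Finset (Fin N)), m / 2 ≤ F.card ∧
      (∀ p ∈ F, ∀ p' ∈ F, (p : ℕ) % 2 = (p' : ℕ) % 2) ∧
      ∀ p ∈ F, ∃ u : Fin N, (u : ℕ) + 1 = p ∧ (p ∈ S.biUnion P ↔ u ∉ S.biUnion P) := by
  obtain ⟨hne, hdisj, hcov⟩ := hP
  have hc : ∀ v, ∃ t, v ∈ P t := fun v => by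
    have : v ∈ univ.biUnion P := by rw [hcov]; exact Finset.mem_univ v
    simpa using this
  choose c hc using hc
  have huniq : ∀ {v t}, v ∈ P t → c v = t := fun {v t} hv => by
    by_contra h
    exact (Finset.disjoint_left.1 (hdisj _ _ h)) (hc v) hv
  have hN : 0 < N := ((hne ⟨0, by omega⟩).choose).pos
  set f : Fin m → Fin N := fun t => (P t).min' (hne t)
  have hfmem : ∀ t, f t ∈ P t := fun t => Finset.min'_mem _ _
  have hfinj : Function.Injective f := fun t t' h => by
    rw [← huniq (hfmem t), h, huniq (hfmem t')]
  have hfle : ∀ v, f (c v) ≤ v := fun v => Finset.min'_le _ _ (hc v)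
  set prev : Fin N → Fin N := fun v => ⟨v - 1, by omega⟩ with hprev
  set root := c ⟨0, hN⟩
  have hpos : ∀ t, t ≠ root → 0 < (f t : ℕ) := by
    intro t ht
    by_contra h0
    have : f t = ⟨0, hN⟩ := Fin.ext (by simp; omega)
    exact ht (by rw [← huniq (hfmem t), this])
  obtain ⟨κ, hκ⟩ := exists_alternating (fun t => (f t : ℕ)) root (fun t => c (prev (f t)))
    (fun t ht => by
      have h1 := hpos t ht
      have h2 : (f (c (prev (f t))) : ℕ) ≤ prev (f t) := hfle _
      simp only [hprev] at h2 ⊢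
      omega)
  have hA : ∀ v, v ∈ (univ.filter κ).biUnion P ↔ κ (c v) := by
    intro v
    simp only [Finset.mem_biUnion, Finset.mem_filter, Finset.mem_univ, true_and]
    exact ⟨fun ⟨t, ht, hv⟩ => by rwa [huniq hv], fun h => ⟨_, h, hc v⟩⟩
  have hcard : ∃ r : ℕ,
      m / 2 ≤ ((univ.erase root).filter fun t => (f t : ℕ) % 2 = r).card := by
    by_contra! h
    have h0 := h 0
    have h1 := h 1
    have hs := Finset.card_filter_add_card_filter_not (s := univ.erase root)
      (fun t => (f t : ℕ) % 2 = 0)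
    simp only [Nat.mod_two_ne_zero, Finset.card_erase_of_mem (Finset.mem_univ _),
      Finset.card_univ, Fintype.card_fin] at hs
    omega
  obtain ⟨r, hr⟩ := hcard
  refine ⟨univ.filter κ, ((univ.erase root).filter fun t => (f t : ℕ) % 2 = r).image f, ?_, ?_, ?_⟩
  · rwa [Finset.card_image_of_injective _ hfinj]
  · simp only [Finset.mem_image, Finset.mem_filter]
    rintro _ ⟨t, ⟨_, ht⟩, rfl⟩ _ ⟨t', ⟨_, ht'⟩, rfl⟩
    rw [ht, ht']
  · intro p hp
    obtain ⟨t, ht, rfl⟩ := Finset.mem_image.1 hp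
    have ht' : t ≠ root := Finset.ne_of_mem_erase (Finset.mem_filter.1 ht).1
    have := hpos t ht'
    refine ⟨prev (f t), by simp only [hprev]; omega, ?_⟩
    rw [hA, hA, huniq (hfmem t)]
    exact hκ t ht'

/-- Along a path, `nbrSum` is the sum over the two possible neighbours. -/
lemma nbrSum_pathGraph {N : ℕ} (i : Fin N) (d : Fin N → ZMod 2) :
    nbrSum (pathGraph N) i d = (∑ j : Fin N, if (i : ℕ) + 1 = j then d j else 0)
      + ∑ j : Fin N, if (j : ℕ) + 1 = i then d j else 0 := by
  rw [nbrSum, Finset.sum_filter, ← Finset.sum_add_distrib]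
  refine Finset.sum_congr rfl fun j _ => ?_
  simp only [pathGraph_adj]
  by_cases h1 : (i : ℕ) + 1 = j
  · have h2 : ¬ (j : ℕ) + 1 = i := by omega
    simp [h1, h2]
  · simp [h1]

lemma exists_isPhase_pathGraph (N : ℕ) : ∃ q, IsPhase (pathGraph N) q := by
  refine ⟨fun x => ∑ i : Fin N, ∑ j : Fin N, if (i : ℕ) + 1 = j then x i * x j else 0,
    fun k x => ?_⟩
  have e : ∀ i j : Fin N, (if (i : ℕ) + 1 = j then (x + delta k) i * (x + delta k) j else 0)
      = (if (i : ℕ) + 1 = j then x i * x j else 0)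
        + (if i = k then (if (i : ℕ) + 1 = j then x j else 0) else 0)
        + (if j = k then (if (i : ℕ) + 1 = j then x i else 0) else 0) := by
    intro i j
    by_cases hij : (i : ℕ) + 1 = j
    · simp only [if_pos hij, Pi.add_apply, delta]
      split_ifs with hi hj
      · omega
      all_goals ring
    · simp [hij]
  simp only [e, Finset.sum_add_distrib, nbrSum_pathGraph]
  rw [add_assoc]
  congr 2
  · rw [Finset.sum_comm]
    simp
  · simp

omit [Fintype V] in
lemma glue_restrict (A : Finset V) (x : V → ZMod 2) :
    glue A (restrictTo A x) (restrictOut A x) = x := by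
  ext v
  simp [glue, restrictTo, restrictOut]

omit [Fintype V] in
lemma restrictTo_glue (A : Finset V) (a : {v // v ∈ A} → ZMod 2) (b : {v // v ∉ A} → ZMod 2) :
    restrictTo A (glue A a b) = a := by
  ext v
  simp [glue, restrictTo]

omit [Fintype V] in
lemma restrictOut_glue (A : Finset V) (a : {v // v ∈ A} → ZMod 2) (b : {v // v ∉ A} → ZMod 2) :
    restrictOut A (glue A a b) = b := by
  ext v
  simp [glue, restrictOut, v.2]

omit [Fintype V] in
lemma glue_sub (A : Finset V) (a a' : {v // v ∈ A} → ZMod 2) (b b' : {v // v ∉ A} → ZMod 2) :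
    glue A (a - a') (b - b') = glue A a b - glue A a' b' := by
  ext v
  by_cases h : v ∈ A <;> simp [glue, h]

omit [Fintype V] in
lemma glue_add_delta (A : Finset V) (a : {v // v ∈ A} → ZMod 2) (b : {v // v ∉ A} → ZMod 2)
    {i : V} (hi : i ∉ A) :
    glue A a (b + restrictOut A (delta i)) = glue A a b + delta i := by
  ext v
  by_cases h : v ∈ A
  · have : v ≠ i := by rintro rfl; exact hi h
    simp [glue, h, delta_apply_ne this]
  · simp [glue, h, restrictOut]

/-- Bit strings on `V` are pairs of bit strings on `A` and on its complement. -/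
def glueEquiv (A : Finset V) :
    (({v // v ∈ A} → ZMod 2) × ({v // v ∉ A} → ZMod 2)) ≃ (V → ZMod 2) where
  toFun p := glue A p.1 p.2
  invFun x := (restrictTo A x, restrictOut A x)
  left_inv p := Prod.ext (restrictTo_glue A p.1 p.2) (restrictOut_glue A p.1 p.2)
  right_inv x := glue_restrict A x

lemma sum_glue {M : Type*} [AddCommMonoid M] (A : Finset V) (F : (V → ZMod 2) → M) :
    ∑ x, F x = ∑ b, ∑ a, F (glue A a b) := by
  rw [← Equiv.sum_comp (glueEquiv A), Fintype.sum_prod_type, Finset.sum_comm]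
  rfl

lemma isProdVec_of_fullSepPure {m : ℕ} {P : Fin m → Finset V} (hP : IsPartition P)
    {ψ : (V → ZMod 2) → ℂ} (hψ : FullSepPure P ψ) (S : Finset (Fin m)) :
    IsProdVec (S.biUnion P) ψ := by
  obtain ⟨φ, hφ⟩ := hψ
  set A := S.biUnion P
  refine ⟨fun a => ∏ t ∈ S, φ t (restrictTo (P t) (glue A a 0)),
    fun b => ∏ t ∈ Sᶜ, φ t (restrictTo (P t) (glue A 0 b)), fun x => ?_⟩
  rw [hφ, ← Finset.prod_mul_prod_compl S]
  congr 1
  · refine Finset.prod_congr rfl fun t ht => congrArg _ (funext fun v => ?_)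
    have hv : v.1 ∈ A := Finset.mem_biUnion.2 ⟨t, ht, v.2⟩
    simp [restrictTo, glue, hv]
  · refine Finset.prod_congr rfl fun t ht => congrArg _ (funext fun v => ?_)
    have hv : v.1 ∉ A := by
      rw [Finset.mem_biUnion]
      rintro ⟨t', ht', hv'⟩
      refine Finset.disjoint_left.1 (hP.2.1 t' t ?_) hv' v.2
      rintro rfl
      exact Finset.mem_compl.1 ht ht'
    simp [restrictTo, restrictOut, glue, hv]

lemma sum_bitSign_mul_eq_zero {G : SimpleGraph V} {q : (V → ZMod 2) → ZMod 2} (hq : IsPhase G q)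
    {A : Finset V} {a a' : {v // v ∈ A} → ZMod 2} {i : V} (hi : i ∉ A)
    (hne : nbrSum G i (glue A (a - a') 0) ≠ 0) :
    ∑ b, bitSign (q (glue A a b)) * star (bitSign (q (glue A a' b))) = 0 := by
  set f : ({v // v ∉ A} → ZMod 2) → ℂ :=
    fun b => bitSign (q (glue A a b)) * star (bitSign (q (glue A a' b))) with hf
  have hflip : ∀ b, f (b + restrictOut A (delta i)) = - f b := by
    intro b
    have h1 : nbrSum G i (glue A a b) + nbrSum G i (glue A a' b) = 1 := by
      rw [← CharTwo.sub_eq_add, ← nbrSum_sub, ← glue_sub, sub_self]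
      exact Fin.eq_one_of_ne_zero _ hne
    have h2 : bitSign (nbrSum G i (glue A a b)) * bitSign (nbrSum G i (glue A a' b)) = -1 := by
      rw [← bitSign_add, h1]
      simp [bitSign, ZMod.val_one]
    simp only [hf, star_bitSign, glue_add_delta A _ _ hi, hq i (glue A a b), hq i (glue A a' b),
      bitSign_add]
    linear_combination bitSign (q (glue A a b)) * bitSign (q (glue A a' b)) * h2
  have hsum : ∑ b, f b = - ∑ b, f b := by
    rw [← Finset.sum_neg_distrib]
    simp only [← hflip]
    exact (Equiv.sum_comp (Equiv.addRight (restrictOut A (delta i))) f).symm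
  exact self_eq_neg.1 hsum

lemma card_kernel_mul_le {G : SimpleGraph V} {A T : Finset V} (hTA : T ⊆ A)
    (hinj : ∀ d : V → ZMod 2, (∀ v, v ∉ T → d v = 0) → (∀ b, b ∉ A → nbrSum G b d = 0) → d = 0) :
    (univ.filter fun d : {v // v ∈ A} → ZMod 2 =>
      ∀ b, b ∉ A → nbrSum G b (glue A d 0) = 0).card * 2 ^ T.card ≤ 2 ^ A.card := by
  set K := univ.filter fun d : {v // v ∈ A} → ZMod 2 =>
    ∀ b, b ∉ A → nbrSum G b (glue A d 0) = 0
  have h1 : K.card ≤ (univ : Finset ({v // v ∈ A \ T} → ZMod 2)).card := by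
    refine Finset.card_le_card_of_injOn (fun d => restrictTo (A \ T) (glue A d 0))
      (fun _ _ => Finset.mem_coe.2 (Finset.mem_univ _)) fun d hd d' hd' hdd => ?_
    have hd1 := (Finset.mem_filter.1 (Finset.mem_coe.1 hd)).2
    have hd2 := (Finset.mem_filter.1 (Finset.mem_coe.1 hd')).2
    have hsub : glue A (d - d') 0 = glue A d 0 - glue A d' 0 := by
      rw [← glue_sub, sub_self]
    have h0 : glue A (d - d') 0 = 0 := by
      refine hinj _ (fun v hv => ?_) fun b hb => ?_
      · by_cases hvA : v ∈ A
        · have := congrFun hdd ⟨v, Finset.mem_sdiff.2 ⟨hvA, hv⟩⟩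
          simp only [restrictTo] at this
          rw [hsub, Pi.sub_apply, this, sub_self]
        · simp [glue, hvA]
      · rw [hsub, nbrSum_sub, hd1 b hb, hd2 b hb, sub_zero]
    have h := restrictTo_glue A (d - d') 0
    rw [h0] at h
    exact sub_eq_zero.1 h.symm
  have h2 : (univ : Finset ({v // v ∈ A \ T} → ZMod 2)).card = 2 ^ (A.card - T.card) := by
    rw [← Finset.card_sdiff_of_subset hTA]
    rw [Finset.card_univ, Fintype.card_fun, ZMod.card, Fintype.card_coe]
  calc K.card * 2 ^ T.card ≤ 2 ^ (A.card - T.card) * 2 ^ T.card :=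
        Nat.mul_le_mul_right _ (h1.trans h2.le)
    _ = 2 ^ A.card := by rw [← pow_add, Nat.sub_add_cancel (Finset.card_le_card hTA)]

/-- The overlap of a graph state with a product vector across `A` is at most `2 ^ (-#T)` whenever
the rows of the cut matrix of `A` belonging to `T ⊆ A` are linearly independent. -/
lemma graph_overlap_le {G : SimpleGraph V} {q : (V → ZMod 2) → ZMod 2} (hq : IsPhase G q)
    {A T : Finset V} (hTA : T ⊆ A)
    (hinj : ∀ d : V → ZMod 2, (∀ v, v ∉ T → d v = 0) → (∀ b, b ∉ A → nbrSum G b d = 0) → d = 0)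
    {ψ : (V → ZMod 2) → ℂ} (hψ : IsUnit' ψ) (hprod : IsProdVec A ψ) :
    (2 ^ Fintype.card V)⁻¹ * ‖∑ x, bitSign (q x) * ψ x‖ ^ 2 ≤ ((2 : ℝ) ^ T.card)⁻¹ := by
  obtain ⟨φ, χ, hφχ⟩ := hprod
  have hglue : ∀ a b, ψ (glue A a b) = φ a * χ b := fun a b => by
    rw [hφχ, restrictTo_glue, restrictOut_glue]
  have hnorm : (∑ a, ‖φ a‖ ^ 2) * ∑ b, ‖χ b‖ ^ 2 = 1 := by
    have h1 : ∑ x, ‖ψ x‖ ^ 2 = 1 := by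
      have h : star ψ ⬝ᵥ ψ = 1 := hψ
      simp only [dotProduct, Pi.star_apply, RCLike.star_def, Complex.conj_mul'] at h
      exact_mod_cast h
    rw [← h1, sum_glue A, Finset.sum_mul_sum, Finset.sum_comm]
    simp only [hglue, norm_mul, mul_pow]
  set K := univ.filter fun d : {v // v ∈ A} → ZMod 2 =>
    ∀ b, b ∉ A → nbrSum G b (glue A d 0) = 0
  have hker := norm_sum_kernel_sq_le (fun a b => bitSign (q (glue A a b)))
    (fun a b => (norm_bitSign _).le) K (fun a a' haa => by
      have : ¬ ∀ b, b ∉ A → nbrSum G b (glue A (a - a') 0) = 0 := fun h =>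
        haa (Finset.mem_filter.2 ⟨Finset.mem_univ _, h⟩)
      push Not at this
      obtain ⟨i, hi, hne⟩ := this
      exact sum_bitSign_mul_eq_zero hq hi hne) φ χ
  have hcardK : (K.card : ℝ) * 2 ^ T.card ≤ 2 ^ A.card := by
    exact_mod_cast card_kernel_mul_le hTA hinj
  have hcardB : (Fintype.card ({v // v ∉ A} → ZMod 2) : ℝ) * 2 ^ A.card = 2 ^ Fintype.card V := by
    have h : Fintype.card {v // v ∉ A} + A.card = Fintype.card V := by
      rw [Fintype.card_subtype_compl, Fintype.card_coe, Nat.sub_add_cancel (Finset.card_le_univ A)]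
    rw [← h, pow_add]
    simp [ZMod.card]
  rw [mul_assoc, hnorm, mul_one] at hker
  rw [sum_glue A]
  simp only [hglue]
  rw [inv_mul_le_iff₀ (by positivity), ← div_eq_mul_inv, le_div_iff₀ (by positivity), ← hcardB]
  refine (mul_le_mul_of_nonneg_right hker (by positivity)).trans ?_
  rw [mul_assoc]
  exact mul_le_mul_of_nonneg_left hcardK (by positivity)

lemma eq_zero_of_nbrSum_pathGraph_eq_zero {N : ℕ} (i : Fin N) (d : Fin N → ZMod 2) {j : Fin N}
    (hj : (pathGraph N).Adj i j) (h : nbrSum (pathGraph N) i d = 0)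
    (h' : ∀ j', (pathGraph N).Adj i j' → j' ≠ j → d j' = 0) : d j = 0 := by
  rw [nbrSum, Finset.sum_eq_single_of_mem j (by simpa using hj) fun j' hj' hne =>
    h' j' (Finset.mem_filter.1 hj').2 hne] at h
  exact h

/-- Disjoint crossing edges of a path, all starting at vertices of the same parity, have
linearly independent rows in the cut matrix. -/
lemma exists_independent_rows {N : ℕ} {A F : Finset (Fin N)}
    (hpar : ∀ p ∈ F, ∀ p' ∈ F, (p : ℕ) % 2 = (p' : ℕ) % 2)
    (hcross : ∀ p ∈ F, ∃ u : Fin N, (u : ℕ) + 1 = p ∧ (p ∈ A ↔ u ∉ A)) :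
    ∃ T ⊆ A, T.card = F.card ∧ ∀ d : Fin N → ZMod 2, (∀ v, v ∉ T → d v = 0) →
      (∀ b, b ∉ A → nbrSum (pathGraph N) b d = 0) → d = 0 := by
  choose! u hu hucross using hcross
  have hT : ∀ {v}, v ∈ F.image (fun p => if p ∈ A then p else u p) ↔
      (v ∈ F ∧ v ∈ A) ∨ ∃ p ∈ F, p ∉ A ∧ (v : ℕ) + 1 = p := by
    intro v
    rw [Finset.mem_image]
    constructor
    · rintro ⟨p, hp, rfl⟩
      split_ifs with hpA
      · exact Or.inl ⟨hp, hpA⟩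
      · exact Or.inr ⟨p, hp, hpA, hu p hp⟩
    · rintro (⟨hv, hvA⟩ | ⟨p, hp, hpA, hvp⟩)
      · exact ⟨v, hv, if_pos hvA⟩
      · refine ⟨p, hp, ?_⟩
        rw [if_neg hpA]
        have := hu p hp
        exact Fin.ext (by omega)
  refine ⟨F.image (fun p => if p ∈ A then p else u p), ?_, ?_, ?_⟩
  · rintro v hv
    obtain ⟨p, hp, rfl⟩ := Finset.mem_image.1 hv
    split_ifs with hpA
    · exact hpA
    · by_contra h
      exact hpA ((hucross p hp).2 h)
  · refine Finset.card_image_of_injOn fun p hp p' hp' h => ?_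
    have h1 := hpar p hp p' hp'
    have h2 := hu p hp
    have h3 := hu p' hp'
    split_ifs at h <;> have h4 := congrArg Fin.val h <;> exact Fin.ext (by omega)
  · intro d hd hb
    have hup : ∀ n, ∀ p ∈ F, p ∈ A → (p : ℕ) = n → d p = 0 := by
      intro n
      induction n using Nat.strong_induction_on with
      | _ n ih =>
        rintro p hp hpA rfl
        have h1 := hu p hp
        have huA : u p ∉ A := (hucross p hp).1 hpA
        refine eq_zero_of_nbrSum_pathGraph_eq_zero (u p) d ((pathGraph_adj _ _).2 (Or.inl h1))
          (hb _ huA) fun j hj hjp => ?_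
        have hjp' : (j : ℕ) ≠ p := fun h => hjp (Fin.ext h)
        have hj2 : (j : ℕ) + 2 = p := by
          rcases (pathGraph_adj _ _).1 hj with h | h <;> omega
        by_cases hjT : j ∈ F.image (fun p => if p ∈ A then p else u p)
        · rcases hT.1 hjT with ⟨hjF, hjA⟩ | ⟨p', hp', -, h⟩
          · exact ih j (by omega) j hjF hjA rfl
          · have := hpar p hp p' hp'
            omega
        · exact hd j hjT
    have hdown : ∀ n, ∀ p ∈ F, p ∉ A → ∀ v : Fin N, (v : ℕ) + 1 = p → N - (p : ℕ) = n →
        d v = 0 := by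
      intro n
      induction n using Nat.strong_induction_on with
      | _ n ih =>
        rintro p hp hpA v hv rfl
        refine eq_zero_of_nbrSum_pathGraph_eq_zero p d ((pathGraph_adj _ _).2 (Or.inr hv))
          (hb _ hpA) fun j hj hjp => ?_
        have hjp' : (j : ℕ) ≠ v := fun h => hjp (Fin.ext h)
        have hj2 : (p : ℕ) + 1 = j := by
          rcases (pathGraph_adj _ _).1 hj with h | h <;> omega
        by_cases hjT : j ∈ F.image (fun p => if p ∈ A then p else u p)
        · rcases hT.1 hjT with ⟨hjF, hjA⟩ | ⟨p', hp', hp'A, h⟩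
          · have := hpar p hp j hjF
            omega
          · exact ih (N - p') (by omega) p' hp' hp'A j h rfl
        · exact hd j hjT
    ext v
    by_cases hv : v ∈ F.image (fun p => if p ∈ A then p else u p)
    · rcases hT.1 hv with ⟨hvF, hvA⟩ | ⟨p, hp, hpA, h⟩
      · exact hup v v hvF hvA rfl
      · exact hdown _ p hp hpA v h rfl
    · exact hd v hv

lemma quadForm_add_le_of_fullSepPure {N m : ℕ} (hm : 2 ≤ m) {q : (Fin N → ZMod 2) → ZMod 2}
    (hq : IsPhase (pathGraph N) q) {W W' : Finset (Fin N)} (hW : W ∪ W' = univ)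
    {P : Fin m → Finset (Fin N)} (hP : IsPartition P) {ψ : (Fin N → ZMod 2) → ℂ}
    (hψ : IsUnit' ψ) (hsep : FullSepPure P ψ) :
    star ψ ⬝ᵥ projMat q W *ᵥ ψ + star ψ ⬝ᵥ projMat q W' *ᵥ ψ
      ≤ ((1 + ((2 : ℝ) ^ (m / 2))⁻¹ : ℝ) : ℂ) := by
  obtain ⟨S, F, hF, hpar, hcross⟩ := exists_crossing_matching hm hP
  obtain ⟨T, hTA, hTF, hinj⟩ := exists_independent_rows hpar hcross
  have h := graph_overlap_le hq hTA hinj hψ (isProdVec_of_fullSepPure hP hsep S)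
  have h' : ((2 : ℝ) ^ T.card)⁻¹ ≤ ((2 : ℝ) ^ (m / 2))⁻¹ := by
    rw [hTF]
    exact inv_anti₀ (by positivity) (pow_le_pow_right₀ (by norm_num) hF)
  refine (quadForm_add_le hq hW hψ).trans ?_
  rw [quadForm_projMat_univ, ← Complex.ofReal_one, ← Complex.ofReal_add]
  exact Complex.real_le_real.2 (by linarith)

lemma trace_mul_mixture {ι : Type*} [Fintype ι] (M : Matrix (V → ZMod 2) (V → ZMod 2) ℂ)
    (p : ι → ℝ) (ψ : ι → (V → ZMod 2) → ℂ) :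
    (M * ∑ i, (p i : ℂ) • vecMulVec (ψ i) (star (ψ i))).trace
      = ∑ i, (p i : ℂ) * (star (ψ i) ⬝ᵥ M *ᵥ ψ i) := by
  rw [Matrix.mul_sum, Matrix.trace_sum]
  refine Finset.sum_congr rfl fun i _ => ?_
  rw [Matrix.mul_smul, Matrix.trace_smul, Matrix.mul_vecMulVec, Matrix.trace_vecMulVec,
    dotProduct_comm, smul_eq_mul]

/-- Corollary 3: for the path graph on `N` vertices with the 2-coloring into odd-labelled
vertices (even indices) and even-labelled vertices (odd indices), for every `2 ≤ m ≤ N`,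
every `m`-separable density matrix `ρ` satisfies
`Tr(P_1 ρ) + Tr(P_2 ρ) ≤ 1 + 2^{-⌊m/2⌋}`. -/
theorem witness_mSep_path (N m : ℕ) (hm : 2 ≤ m) (hmN : m ≤ N)
    (ρ : Matrix (Fin N → ZMod 2) (Fin N → ZMod 2) ℂ) (hρd : IsDensity ρ)
    (hρ : MSep m ρ) :
    (stabProj (pathGraph N) (univ.filter fun v : Fin N => (v : ℕ) % 2 = 0) * ρ).trace
      + (stabProj (pathGraph N) (univ.filter fun v : Fin N => (v : ℕ) % 2 = 1) * ρ).trace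
      ≤ ((1 + ((2 : ℝ) ^ (m / 2))⁻¹ : ℝ) : ℂ) := by
  obtain ⟨q, hq⟩ := exists_isPhase_pathGraph N
  obtain ⟨M, p, ψ, hp, hp1, hu, hsep, rfl⟩ := hρ
  rw [stabProj_eq_projMat hq, stabProj_eq_projMat hq, trace_mul_mixture, trace_mul_mixture,
    ← Finset.sum_add_distrib]
  have hW : (univ.filter fun v : Fin N => (v : ℕ) % 2 = 0)
      ∪ (univ.filter fun v : Fin N => (v : ℕ) % 2 = 1) = univ := by
    ext v
    have := Nat.mod_two_eq_zero_or_one v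
    simpa using this
  have hbound : ∀ i, (p i : ℂ) * (star (ψ i) ⬝ᵥ projMat q _ *ᵥ ψ i)
      + (p i : ℂ) * (star (ψ i) ⬝ᵥ projMat q _ *ᵥ ψ i)
      ≤ (p i : ℂ) * ((1 + ((2 : ℝ) ^ (m / 2))⁻¹ : ℝ) : ℂ) := fun i => by
    obtain ⟨P, hP, hPsep⟩ := hsep i
    rw [← mul_add]
    exact mul_le_mul_of_nonneg_left
      (quadForm_add_le_of_fullSepPure hm hq hW hP (hu i) hPsep)
      (Complex.zero_le_real.2 (hp i))
  refine (Finset.sum_le_sum fun i _ => hbound i).trans ?_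
  rw [← Finset.sum_mul, ← Complex.ofReal_sum, hp1, Complex.ofReal_one, one_mul]
end
end
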